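/- arXiv:2207.08342 — 2 statements merged into one kernel-verified Lean document; each statement's English description precedes it below -/
import Mathlib

section
/- Let d ∈ ℕ, and let B > 0 and ε > 0 be real numbers. Fix θ* ∈ ℝ^d with ‖θ*‖₂ ≤ B. Suppose (x₁, θ₁), …, (x_τ, θ_τ) is a finite sequence with x_i ∈ ℝ^d, ‖x_i‖₂ ≤ 1, θ_i ∈ ℝ^d, ‖θ_i‖₂ ≤ B, such that for every i ∈ {1,…,τ}: |⟨θ_i, x_i⟩ − ⟨θ*, x_i⟩| > ε and ∑_{j<i} (⟨θ_i, x_j⟩ − ⟨θ*, x_j⟩)² ≤ ε². Then τ ≤ 3·d·(e/(e−1))·ln(3 + 3·(2B/ε)²) + 1. -/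
open scoped RealInnerProductSpace

open Matrix in
/-- The **matrix determinant lemma** for the rank-one update `vecMulVec u v`. -/
theorem Matrix.det_add_vecMulVec_of_isUnit {n R : Type*} [Fintype n] [DecidableEq n] [CommRing R]
    {A : Matrix n n R} (hA : IsUnit A.det) (u v : n → R) :
    (A + vecMulVec u v).det = A.det * (1 + v ⬝ᵥ (A⁻¹ *ᵥ u)) := by
  rw [vecMulVec_eq Unit, det_add_replicateCol_mul_replicateRow hA, Matrix.mul_assoc]
  congr 1
  simp [det_unique, Matrix.mul_apply, dotProduct, mulVec]

open Matrix in
/-- Log form of the AM-GM inequality between the determinant and the trace. -/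
theorem Matrix.PosDef.log_det_le_card_mul_log {n : Type*} [Fintype n] [DecidableEq n]
    {A : Matrix n n ℝ} (hA : A.PosDef) {m : ℝ} (hm : 0 < m)
    (htr : A.trace ≤ Fintype.card n * m) :
    Real.log A.det ≤ Fintype.card n * Real.log m := by
  have hpos := hA.eigenvalues_pos
  have hdet : A.det = ∏ i, hA.isHermitian.eigenvalues i := by
    simpa using hA.isHermitian.det_eq_prod_eigenvalues
  have htrace : A.trace = ∑ i, hA.isHermitian.eigenvalues i := by
    simpa using hA.isHermitian.trace_eq_sum_eigenvalues
  have hlog : ∀ i, Real.log (hA.isHermitian.eigenvalues i) ≤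
      Real.log m + (hA.isHermitian.eigenvalues i / m - 1) := fun i ↦ by
    have := Real.log_le_sub_one_of_pos (div_pos (hpos i) hm)
    rw [Real.log_div (hpos i).ne' hm.ne'] at this
    linarith
  have hm' : A.trace / m ≤ Fintype.card n := (div_le_iff₀ hm).2 htr
  rw [hdet, Real.log_prod fun i _ ↦ (hpos i).ne']
  calc ∑ i, Real.log (hA.isHermitian.eigenvalues i)
      ≤ ∑ i, (Real.log m + (hA.isHermitian.eigenvalues i / m - 1)) :=
        Finset.sum_le_sum fun i _ ↦ hlog i
    _ = Fintype.card n * Real.log m + (A.trace / m - Fintype.card n) := by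
        simp [Finset.sum_add_distrib, htrace, Finset.sum_div]
    _ ≤ _ := by linarith

/-- The regularized Gram matrix `1 + a ∑_{j < k} x_j x_jᵀ`. -/
noncomputable def regGram {n : Type*} [DecidableEq n] (a : ℝ) (x : ℕ → n → ℝ) (k : ℕ) :
    Matrix n n ℝ :=
  1 + ∑ j ∈ Finset.range k, Matrix.vecMulVec (a • x j) (x j)

namespace regGram

open Matrix

variable {n : Type*} [DecidableEq n] {a : ℝ} {x : ℕ → n → ℝ} {k : ℕ}

theorem succ : regGram a x (k + 1) = regGram a x k + vecMulVec (a • x k) (x k) := by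
  simp [regGram, Finset.sum_range_succ, add_assoc]

variable [Fintype n]

theorem posDef (ha : 0 ≤ a) : (regGram a x k).PosDef := by
  refine PosDef.one.add_posSemidef (posSemidef_sum _ fun j _ ↦ ?_)
  rw [smul_vecMulVec]
  simpa using (posSemidef_vecMulVec_self_star (x j)).smul ha

theorem trace_eq : (regGram a x k).trace =
    Fintype.card n + a * ∑ j ∈ Finset.range k, x j ⬝ᵥ x j := by
  simp [regGram, trace_sum, trace_vecMulVec, Finset.mul_sum]

theorem dotProduct_mulVec (w : n → ℝ) : w ⬝ᵥ (regGram a x k *ᵥ w) =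
    w ⬝ᵥ w + a * ∑ j ∈ Finset.range k, (w ⬝ᵥ x j) ^ 2 := by
  simp only [regGram, add_mulVec, one_mulVec, sum_mulVec, dotProduct_add, dotProduct_sum,
    Finset.mul_sum, vecMulVec_mulVec]
  congr 1
  refine Finset.sum_congr rfl fun j _ ↦ ?_
  simp [dotProduct_comm (x j) w]
  ring

/-- The determinant grows by a factor `3 / 2` when the new point separates a parameter `w` that is
small on the previous points. -/
theorem det_succ_ge (ha : 0 < a) {w : n → ℝ} {ε : ℝ} (hε : 0 < ε) (hw : w ⬝ᵥ w ≤ a * ε ^ 2)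
    (hbig : ε < |w ⬝ᵥ x k|) (hfit : ∑ j ∈ Finset.range k, (w ⬝ᵥ x j) ^ 2 ≤ ε ^ 2) :
    3 / 2 * (regGram a x k).det ≤ (regGram a x (k + 1)).det := by
  have hV : (regGram a x k).PosDef := posDef ha.le
  have hu : IsUnit (regGram a x k).det := hV.det_pos.ne'.isUnit
  set V := regGram a x k with hVdef
  set y := V⁻¹ *ᵥ x k with hy
  have hVy : V *ᵥ y = x k := by rw [hy, mulVec_mulVec, mul_nonsing_inv _ hu, one_mulVec]
  set c := w ⬝ᵥ x k with hc
  have hquad : w ⬝ᵥ (V *ᵥ w) ≤ 2 * a * ε ^ 2 := by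
    rw [hVdef, dotProduct_mulVec]
    nlinarith
  have hc2 : ε ^ 2 < c ^ 2 := by
    rw [← sq_abs c]
    gcongr
  have hyw : y ⬝ᵥ (V *ᵥ w) = c := by
    have hT : Vᵀ = V := by simpa using hV.isHermitian.eq
    rw [Matrix.dotProduct_mulVec, ← mulVec_transpose, hT, hVy, dotProduct_comm]
  have hnn : 0 ≤ w ⬝ᵥ (V *ᵥ w) - 2 * (2 * a * c) * c + (2 * a * c) ^ 2 * (x k ⬝ᵥ y) := by
    have h := hV.posSemidef.dotProduct_mulVec_nonneg (w - (2 * a * c) • y)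
    simp only [star_trivial, mulVec_sub, mulVec_smul, hVy, sub_dotProduct, dotProduct_sub,
      smul_dotProduct, dotProduct_smul, smul_eq_mul, hyw, ← hc, dotProduct_comm y (x k)] at h
    linarith
  have hq : 1 / 2 ≤ a * (x k ⬝ᵥ y) := by
    have hac : 0 < 4 * a * c ^ 2 := by have := sq_nonneg ε; nlinarith
    have : 0 ≤ 4 * a * c ^ 2 * (a * (x k ⬝ᵥ y) - 1 / 2) := by nlinarith
    linarith [nonneg_of_mul_nonneg_right this hac]
  rw [succ, det_add_vecMulVec_of_isUnit hu, mulVec_smul, dotProduct_smul, smul_eq_mul, ← hy]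
  nlinarith [hV.det_pos]

end regGram

open Matrix in
/-- Elliptical potential bound: along an Eluder sequence, the length is controlled by the
logarithm of the total information. -/
theorem eluder_log_bound {n : Type*} [Fintype n] [Nonempty n] {τ : ℕ} {a ε : ℝ} (ha : 0 < a)
    (hε : 0 < ε) {x w : ℕ → n → ℝ} (hx : ∀ k < τ, x k ⬝ᵥ x k ≤ 1)
    (hw : ∀ k < τ, w k ⬝ᵥ w k ≤ a * ε ^ 2) (hbig : ∀ k < τ, ε < |w k ⬝ᵥ x k|)
    (hfit : ∀ k < τ, ∑ j ∈ Finset.range k, (w k ⬝ᵥ x j) ^ 2 ≤ ε ^ 2) :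
    τ * Real.log (3 / 2) ≤ Fintype.card n * Real.log (1 + a * (τ / Fintype.card n)) := by
  classical
  have hcard : (0 : ℝ) < Fintype.card n := by exact_mod_cast Fintype.card_pos
  have hdet : ∀ k ≤ τ, (3 / 2 : ℝ) ^ k ≤ (regGram a x k).det := by
    intro k
    induction k with
    | zero => simp [regGram]
    | succ k ih =>
      intro hk
      have h := regGram.det_succ_ge ha hε (hw k hk) (hbig k hk) (hfit k hk)
      rw [pow_succ]
      linarith [ih (Nat.le_of_succ_le hk)]
  rw [← Real.log_pow]
  refine (Real.log_le_log (by positivity) (hdet τ le_rfl)).trans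
    ((regGram.posDef ha.le).log_det_le_card_mul_log (by positivity) ?_)
  have hsum : ∑ j ∈ Finset.range τ, x j ⬝ᵥ x j ≤ τ := by
    simpa using Finset.sum_le_sum fun j hj ↦ hx j (Finset.mem_range.1 hj)
  rw [regGram.trace_eq]
  calc Fintype.card n + a * ∑ j ∈ Finset.range τ, x j ⬝ᵥ x j
      ≤ Fintype.card n + a * τ := by gcongr
    _ = _ := by field_simp

/-- Explicit upper bound on `t` from the inequality `(3 / 2) ^ t ≤ 1 + a * t`. -/
theorem le_of_mul_log_three_halves_le {a t : ℝ} (ha : 0 ≤ a)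
    (h : t * Real.log (3 / 2) ≤ Real.log (1 + a * t)) :
    t ≤ 3 * (Real.exp 1 / (Real.exp 1 - 1)) * Real.log (3 + 3 * a) := by
  have he : 1 < Real.exp 1 := by simp
  have hL : 1 ≤ Real.log (3 + 3 * a) := by
    rw [Real.le_log_iff_exp_le (by positivity)]
    linarith [Real.exp_one_lt_d9]
  have he' : 1 ≤ Real.exp 1 / (Real.exp 1 - 1) := (one_le_div (by linarith)).2 (by linarith)
  rcases lt_or_ge t 1 with ht | ht
  · nlinarith [mul_le_mul he' hL zero_le_one (by linarith)]
  · have hlog : 1 / 3 ≤ Real.log (3 / 2) := by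
      have := Real.one_sub_inv_le_log_of_pos (show (0 : ℝ) < 3 / 2 by norm_num)
      norm_num at this ⊢
      exact this
    have hsplit : Real.log (1 + a * t) ≤ Real.log (3 + 3 * a) + Real.log (t / 3) := by
      rw [← Real.log_mul (by positivity) (by positivity)]
      exact Real.log_le_log (by positivity) (by linarith)
    have hdiv : Real.log (t / 3) ≤ t / 3 / Real.exp 1 := by
      have := Real.log_le_sub_one_of_pos (show 0 < t / 3 / Real.exp 1 by positivity)
      rw [Real.log_div (by positivity) (by positivity), Real.log_exp] at this
      linarith
    have hmain : t / 3 ≤ Real.log (3 + 3 * a) + t / 3 / Real.exp 1 := by nlinarith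
    have hkey : t * (Real.exp 1 - 1) ≤ 3 * Real.exp 1 * Real.log (3 + 3 * a) := by
      have := mul_le_mul_of_nonneg_right hmain (show 0 ≤ 3 * Real.exp 1 by positivity)
      rw [add_mul, show t / 3 / Real.exp 1 * (3 * Real.exp 1) = t by field_simp] at this
      linarith
    rw [mul_div_assoc', div_mul_eq_mul_div, le_div_iff₀ (by linarith)]
    exact hkey

/-- Eluder dimension bound for bounded linear function classes:
any Eluder sequence at scale `ε` (w.r.t. reference parameter `θs`) of points
`x i` with parameters `θ i`, all bounded, has length at most
`3 d (e/(e-1)) ln(3 + 3 (2B/ε)²) + 1`. -/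
theorem eluder_dimension_linear_bound
    (d τ : ℕ) (B ε : ℝ) (hB : 0 < B) (hε : 0 < ε)
    (θs : EuclideanSpace ℝ (Fin d)) (hθs : ‖θs‖ ≤ B)
    (x : Fin τ → EuclideanSpace ℝ (Fin d)) (hx : ∀ i, ‖x i‖ ≤ 1)
    (θ : Fin τ → EuclideanSpace ℝ (Fin d)) (hθ : ∀ i, ‖θ i‖ ≤ B)
    (hbig : ∀ i : Fin τ, |(⟪θ i, x i⟫ - ⟪θs, x i⟫)| > ε)
    (hfit : ∀ i : Fin τ, ∑ j ∈ Finset.Iio i, (⟪θ i, x j⟫ - ⟪θs, x j⟫) ^ 2 ≤ ε ^ 2) :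
    (τ : ℝ) ≤ 3 * d * (Real.exp 1 / (Real.exp 1 - 1)) *
      Real.log (3 + 3 * (2 * B / ε) ^ 2) + 1 := by
  rcases Nat.eq_zero_or_pos d with rfl | hd
  · have hτ : τ = 0 := by
      by_contra hne
      have h := hbig ⟨0, Nat.pos_of_ne_zero hne⟩
      simp [Subsingleton.elim _ (0 : EuclideanSpace ℝ (Fin 0))] at h
      linarith
    simp [hτ]
  have : Nonempty (Fin d) := ⟨⟨0, hd⟩⟩
  have hd' : (0 : ℝ) < d := by exact_mod_cast hd
  have hinner (u v : EuclideanSpace ℝ (Fin d)) : u.ofLp ⬝ᵥ v.ofLp = ⟪u, v⟫ := by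
    rw [EuclideanSpace.inner_eq_star_dotProduct, star_trivial, dotProduct_comm]
  have hext {P : ℕ → Prop} (h : ∀ i : Fin τ, P i) : ∀ k < τ, P k := fun k hk ↦ h ⟨k, hk⟩
  let X : ℕ → Fin d → ℝ := fun k ↦ if h : k < τ then (x ⟨k, h⟩).ofLp else 0
  let W : ℕ → Fin d → ℝ := fun k ↦ if h : k < τ then (θ ⟨k, h⟩ - θs).ofLp else 0
  have hX (i : Fin τ) : X i = (x i).ofLp := by simp [X]
  have hW (i : Fin τ) : W i = (θ i - θs).ofLp := by simp [W]
  have hmain := eluder_log_bound (τ := τ) (a := (2 * B / ε) ^ 2) (by positivity) hε (x := X) (w := W)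
    (hext fun i ↦ by
      rw [hX, hinner, real_inner_self_eq_norm_sq]
      exact pow_le_one₀ (norm_nonneg _) (hx i))
    (hext fun i ↦ by
      rw [hW, hinner, real_inner_self_eq_norm_sq, ← mul_pow, div_mul_cancel₀ _ hε.ne']
      gcongr
      linarith [norm_sub_le (θ i) θs, hθ i])
    (hext fun i ↦ by
      rw [hW, hX, hinner, inner_sub_left]
      exact hbig i)
    (hext fun i ↦ by
      rw [← Nat.Iio_eq_range, ← Fin.map_valEmbedding_Iio, Finset.sum_map]
      simp only [Fin.valEmbedding_apply, hW, hX, hinner, inner_sub_left]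
      exact hfit i)
  rw [Fintype.card_fin] at hmain
  have ht := le_of_mul_log_three_halves_le (sq_nonneg (2 * B / ε)) (t := τ / d) (by
    rw [div_mul_eq_mul_div, div_le_iff₀ hd']
    linarith)
  rw [div_le_iff₀ hd'] at ht
  linarith
end

section
/- Let D ∈ ℕ, let ε > 0 and E ≥ 1 be real numbers, and let θ*, θ₁, …, θ_τ ∈ ℝ^D and x₁, …, x_τ ∈ ℝ^D with τ ≤ E + 1. Suppose that: (a) for every i ∈ {1,…,τ} and every j < i, |⟨θ_i, x_j⟩| ≤ ε/(2√E); (b) for every i ∈ {1,…,τ} and every j ≤ i, |⟨θ*, x_j⟩| ≤ ε/(2√E); and (c) for every i ∈ {1,…,τ}, |⟨θ_i, x_i⟩| > 2ε. Then for every i ∈ {1,…,τ}: |⟨θ_i, x_i⟩ − ⟨θ*, x_i⟩| > ε and ∑_{j<i} (⟨θ_i, x_j⟩ − ⟨θ*, x_j⟩)² ≤ ε². -/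
open scoped RealInnerProductSpace

/-- The deterministic core of the iteration-complexity argument for Delphi:
parameters consistent (up to tolerance `ε/(2√E)`) with all previously recorded
TD vectors, yet inconsistent (by more than `2ε`) with the newly measured one,
form an Eluder sequence at scale `ε` with respect to the expert parameter `θs`. -/
theorem delphi_eluder_sequence
    (D τ : ℕ) (ε E : ℝ) (hε : 0 < ε) (hE : 1 ≤ E)
    (θs : EuclideanSpace ℝ (Fin D))
    (θ : Fin τ → EuclideanSpace ℝ (Fin D))
    (x : Fin τ → EuclideanSpace ℝ (Fin D))
    (hτ : (τ : ℝ) ≤ E + 1)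
    (ha : ∀ i : Fin τ, ∀ j : Fin τ, j < i → |(⟪θ i, x j⟫ : ℝ)| ≤ ε / (2 * Real.sqrt E))
    (hb : ∀ i : Fin τ, ∀ j : Fin τ, j ≤ i → |(⟪θs, x j⟫ : ℝ)| ≤ ε / (2 * Real.sqrt E))
    (hc : ∀ i : Fin τ, |(⟪θ i, x i⟫ : ℝ)| > 2 * ε) :
    ∀ i : Fin τ,
      |(⟪θ i, x i⟫ : ℝ) - ⟪θs, x i⟫| > ε ∧
      ∑ j ∈ Finset.Iio i, ((⟪θ i, x j⟫ : ℝ) - ⟪θs, x j⟫) ^ 2 ≤ ε ^ 2 := by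
  intro i
  have hsqrt : 1 ≤ Real.sqrt E := Real.one_le_sqrt.mpr hE
  have htol : ε / (2 * Real.sqrt E) ≤ ε / 2 := by
    gcongr
    linarith
  refine ⟨?_, ?_⟩
  · have h := abs_sub_abs_le_abs_sub (⟪θ i, x i⟫ : ℝ) ⟪θs, x i⟫
    linarith [hb i i le_rfl, hc i]
  · have hterm : ∀ j ∈ Finset.Iio i, ((⟪θ i, x j⟫ : ℝ) - ⟪θs, x j⟫) ^ 2 ≤ ε ^ 2 / E := by
      intro j hj
      rw [Finset.mem_Iio] at hj
      have habs : |(⟪θ i, x j⟫ : ℝ) - ⟪θs, x j⟫| ≤ ε / Real.sqrt E := by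
        calc |(⟪θ i, x j⟫ : ℝ) - ⟪θs, x j⟫|
            ≤ |(⟪θ i, x j⟫ : ℝ)| + |(⟪θs, x j⟫ : ℝ)| := abs_sub _ _
          _ ≤ ε / (2 * Real.sqrt E) + ε / (2 * Real.sqrt E) :=
              add_le_add (ha i j hj) (hb i j hj.le)
          _ = ε / Real.sqrt E := by ring
      calc ((⟪θ i, x j⟫ : ℝ) - ⟪θs, x j⟫) ^ 2
          ≤ (ε / Real.sqrt E) ^ 2 := sq_le_sq.mpr (habs.trans (le_abs_self _))
        _ = ε ^ 2 / E := by rw [div_pow, Real.sq_sqrt (by linarith)]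
    have hcard : ((i : ℕ) : ℝ) ≤ E := by
      have : ((i : ℕ) : ℝ) + 1 ≤ τ := by exact_mod_cast i.isLt
      linarith
    calc ∑ j ∈ Finset.Iio i, ((⟪θ i, x j⟫ : ℝ) - ⟪θs, x j⟫) ^ 2
        ≤ (Finset.Iio i).card • (ε ^ 2 / E) := Finset.sum_le_card_nsmul _ _ _ hterm
      _ = (i : ℕ) * (ε ^ 2 / E) := by rw [Fin.card_Iio, nsmul_eq_mul]
      _ ≤ E * (ε ^ 2 / E) := by gcongr
      _ = ε ^ 2 := by field_simp
end
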